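/- Fix an integer n ≥ 1 and p ∈ (0,1), and for each D ≥ 1 let 𝔍 = 𝔍(D) be the random monomial ideal of the ER-type model with parameter p. Then the expected number of minimal generators satisfies lim_{D→∞} E[β₁(S/𝔍)] = p · Σ_{k=0}^{∞} τ_n(k+2) · (1−p)^k, where τ_n(m) denotes the number of ordered n-tuples (a₁,…,aₙ) of positive integers with a₁·a₂·⋯·aₙ = m. -/

import Mathlib

open Finset MvPolynomial Filter

noncomputable section

/-- The set of exponent vectors of nonconstant monomials in `n` variables of total degree
at most `D`. -/
def monSet (n D : ℕ) : Finset (Fin n → ℕ) :=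
  (Fintype.piFinset fun _ : Fin n => Finset.range (D + 1)).filter
    fun α => 0 < ∑ i, α i ∧ ∑ i, α i ≤ D

/-- The monomial `x^α` of `MvPolynomial (Fin n) K` with exponent vector `α`. -/
def mono (K : Type*) [CommRing K] {n : ℕ} (α : Fin n → ℕ) : MvPolynomial (Fin n) K :=
  MvPolynomial.monomial (Finsupp.equivFunOnFinite.symm α) 1

/-- The monomial ideal generated by a set of exponent vectors. -/
def idealOf (K : Type*) [CommRing K] {n : ℕ} (B : Finset (Fin n → ℕ)) :
    Ideal (MvPolynomial (Fin n) K) :=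
  Ideal.span (mono K '' (B : Set (Fin n → ℕ)))

open Classical in
/-- The probability, under the ER-type model `ℐ(n,D,p)`, of the event `E` on random
generating sets `𝔅 ⊆ M(n,D)`. -/
def ERprob (n D : ℕ) (p : ℝ) (E : Set (Finset (Fin n → ℕ))) : ℝ :=
  ∑ B ∈ (monSet n D).powerset.filter (· ∈ E),
    p ^ B.card * (1 - p) ^ ((monSet n D).card - B.card)

/-- `I` is a monomial ideal. -/
def IsMonomialIdeal (K : Type*) [CommRing K] {n : ℕ}
    (I : Ideal (MvPolynomial (Fin n) K)) : Prop :=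
  ∃ G : Set (Fin n → ℕ), I = Ideal.span (mono K '' G)

/-- `x^α` is a minimal monomial generator of `I`: it lies in `I` and no proper divisor does. -/
def IsMinGen (K : Type*) [CommRing K] {n : ℕ} (I : Ideal (MvPolynomial (Fin n) K))
    (α : Fin n → ℕ) : Prop :=
  mono K α ∈ I ∧ ∀ β : Fin n → ℕ, (∀ i, β i ≤ α i) → β ≠ α → mono K β ∉ I

/-- `β₁(S/I)`: the number of minimal monomial generators of `I`. -/
def beta1 (K : Type*) [CommRing K] {n : ℕ} (I : Ideal (MvPolynomial (Fin n) K)) : ℕ :=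
  {α : Fin n → ℕ | IsMinGen K I α}.ncard

/-- `β_{1,d}(S/I)`: the number of minimal monomial generators of `I` of degree `d`. -/
def beta1d (K : Type*) [CommRing K] {n : ℕ} (I : Ideal (MvPolynomial (Fin n) K)) (d : ℕ) : ℕ :=
  {α : Fin n → ℕ | IsMinGen K I α ∧ ∑ i, α i = d}.ncard

/-- `h_I(d)`: the number of monomials of degree exactly `d` not contained in `I`. -/
def hilb (K : Type*) [CommRing K] {n : ℕ} (I : Ideal (MvPolynomial (Fin n) K)) (d : ℕ) : ℕ :=
  {α : Fin n → ℕ | ∑ i, α i = d ∧ mono K α ∉ I}.ncard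

open Classical in
/-- The expectation, under the ER-type model `ℐ(n,D,p)`, of a real random variable `X`
of the random generating set `𝔅 ⊆ M(n,D)`. -/
def ERexp (n D : ℕ) (p : ℝ) (X : Finset (Fin n → ℕ) → ℝ) : ℝ :=
  ∑ B ∈ (monSet n D).powerset,
    p ^ B.card * (1 - p) ^ ((monSet n D).card - B.card) * X B

/-- The order-`n` divisor function `τ_n(m)`: the number of ordered factorizations of `m`
into exactly `n` positive integer parts. -/
def tauOrd (n m : ℕ) : ℕ :=
  {a : Fin n → ℕ | (∀ i, 0 < a i) ∧ ∏ i, a i = m}.ncard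

section RandomMonomialIdeal

variable {n : ℕ}

lemma mem_monSet {D : ℕ} {α : Fin n → ℕ} :
    α ∈ monSet n D ↔ 0 < ∑ i, α i ∧ ∑ i, α i ≤ D := by
  simp only [monSet, mem_filter, Fintype.mem_piFinset, Finset.mem_range, and_iff_right_iff_imp]
  intro h i
  have := Finset.single_le_sum (f := α) (fun j _ => Nat.zero_le _) (Finset.mem_univ i)
  omega

lemma mono_mem_idealOf_iff (K : Type*) [Field K] (B : Finset (Fin n → ℕ)) (β : Fin n → ℕ) :
    mono K β ∈ idealOf K B ↔ ∃ γ ∈ B, γ ≤ β := by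
  have h : mono K '' (B : Set (Fin n → ℕ)) =
      (fun s => monomial s (1 : K)) '' (Finsupp.equivFunOnFinite.symm '' (B : Set (Fin n → ℕ))) := by
    rw [Set.image_image]
    rfl
  classical
  rw [idealOf, h, mem_ideal_span_monomial_image, mono,
    support_monomial, if_neg one_ne_zero]
  simp only [Finset.mem_singleton, forall_eq, Set.exists_mem_image, Finset.mem_coe]
  rfl

lemma isMinGen_idealOf_iff (K : Type*) [Field K] (B : Finset (Fin n → ℕ)) (α : Fin n → ℕ) :
    IsMinGen K (idealOf K B) α ↔ α ∈ B ∧ ∀ β ∈ B, ¬ β < α := by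
  simp only [IsMinGen, mono_mem_idealOf_iff]
  constructor
  · rintro ⟨⟨γ, hγ, hle⟩, hmin⟩
    have hγα : γ = α := by
      by_contra hne
      exact hmin γ hle hne ⟨γ, hγ, le_rfl⟩
    subst hγα
    exact ⟨hγ, fun β hβ hlt => hmin β hlt.le hlt.ne ⟨β, hβ, le_rfl⟩⟩
  · rintro ⟨hα, hmin⟩
    refine ⟨⟨α, hα, le_rfl⟩, fun β hle hne => ?_⟩
    rintro ⟨γ, hγ, hγβ⟩
    exact hmin γ hγ (lt_of_le_of_lt hγβ (lt_of_le_of_ne hle hne))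

/-- For a random subset `B` of `M` including each element independently with probability `p`, the
probability that `B` contains `a` and avoids `T` is `p * (1 - p) ^ T.card`. -/
lemma sum_powerset_mem_disjoint {ι : Type*} [DecidableEq ι] (M T : Finset ι) (a : ι) (p : ℝ)
    (ha : a ∈ M) (hT : T ⊆ M) (haT : a ∉ T) :
    ∑ B ∈ M.powerset, p ^ B.card * (1 - p) ^ (M.card - B.card) *
      (if a ∈ B ∧ ∀ b ∈ B, b ∉ T then 1 else 0) = p * (1 - p) ^ T.card := by
  have key := Finset.prod_add (fun b => if b ∈ T then 0 else p)
    (fun b => if b = a then 0 else 1 - p) M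
  trans ∑ B ∈ M.powerset, (∏ b ∈ B, if b ∈ T then 0 else p) *
      ∏ b ∈ M \ B, if b = a then 0 else 1 - p
  · refine Finset.sum_congr rfl fun B hB => ?_
    rw [mem_powerset] at hB
    split_ifs with h
    · rw [Finset.prod_congr rfl fun b hb => if_neg (h.2 b hb),
        Finset.prod_congr rfl fun b hb => if_neg fun hba : b = a =>
          (Finset.mem_sdiff.1 hb).2 (hba ▸ h.1)]
      simp [Finset.card_sdiff_of_subset hB]
    · rw [mul_zero, eq_comm, mul_eq_zero]
      by_cases haB : a ∈ B
      · left
        have : ∃ b ∈ B, b ∈ T := by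
          by_contra! hcon
          exact h ⟨haB, hcon⟩
        obtain ⟨b, hb, hbT⟩ := this
        exact Finset.prod_eq_zero hb (if_pos hbT)
      · right
        exact Finset.prod_eq_zero (Finset.mem_sdiff.2 ⟨ha, haB⟩) (if_pos rfl)
  · rw [← key, ← Finset.mul_prod_erase M _ ha]
    simp only [if_neg haT, if_true, add_zero]
    congr 1
    have hTe : T ⊆ M.erase a := fun b hb =>
      Finset.mem_erase.2 ⟨fun h => haT (h ▸ hb), hT hb⟩
    rw [← Finset.prod_sdiff hTe, Finset.prod_eq_one, one_mul]
    · rw [← Finset.prod_const]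
      refine Finset.prod_congr rfl fun b hb => ?_
      rw [if_pos hb, if_neg fun h : b = a => haT (h ▸ hb), zero_add]
    · intro b hb
      rw [Finset.mem_sdiff, Finset.mem_erase] at hb
      rw [if_neg hb.2, if_neg hb.1.1]
      ring

open Classical in
lemma card_filter_lt_monSet {D : ℕ} {α : Fin n → ℕ} (hα : α ∈ monSet n D) :
    ((monSet n D).filter (· < α)).card = ∏ i, (α i + 1) - 2 := by
  have h0 : 0 < ∑ i, α i := (mem_monSet.1 hα).1
  have hα0 : α ≠ 0 := by
    rintro rfl
    simp at h0
  have h : (monSet n D).filter (· < α) = ((Finset.Iic α).erase α).erase 0 := by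
    ext β
    simp only [mem_filter, mem_erase, Finset.mem_Iic, mem_monSet]
    constructor
    · rintro ⟨⟨hβ, -⟩, hlt⟩
      refine ⟨?_, hlt.ne, hlt.le⟩
      rintro rfl
      simp at hβ
    · rintro ⟨hβ0, hne, hle⟩
      refine ⟨⟨?_, ?_⟩, lt_of_le_of_ne hle hne⟩
      · rw [Nat.pos_iff_ne_zero]
        intro hs
        apply hβ0
        ext i
        exact Finset.sum_eq_zero_iff.1 hs i (Finset.mem_univ i)
      · exact (Finset.sum_le_sum fun i _ => hle i).trans (mem_monSet.1 hα).2
  rw [h, Finset.card_erase_of_mem, Finset.card_erase_of_mem (by simp), Pi.card_Iic]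
  · simp only [Nat.card_Iic]
    omega
  · simp only [mem_erase, Finset.mem_Iic]
    exact ⟨hα0.symm, fun i => Nat.zero_le _⟩

open Classical in
lemma beta1_idealOf (K : Type*) [Field K] {D : ℕ} {B : Finset (Fin n → ℕ)}
    (hB : B ⊆ monSet n D) :
    (beta1 K (idealOf K B) : ℝ) = ∑ α ∈ monSet n D,
      if α ∈ B ∧ ∀ β ∈ B, β ∉ (monSet n D).filter (· < α) then 1 else 0 := by
  rw [Finset.sum_boole, beta1, ← Set.ncard_coe_finset]
  congr 2
  ext α
  simp only [Set.mem_ofPred_eq, isMinGen_idealOf_iff, coe_filter, mem_filter, not_and]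
  constructor
  · exact fun h => ⟨hB h.1, h.1, fun β hβ _ => h.2 β hβ⟩
  · exact fun h => ⟨h.2.1, fun β hβ => h.2.2 β hβ (hB hβ)⟩

lemma ERexp_beta1 (K : Type*) [Field K] (n D : ℕ) (p : ℝ) :
    ERexp n D p (fun B => (beta1 K (idealOf K B) : ℝ)) =
      ∑ α ∈ monSet n D, p * (1 - p) ^ (∏ i, (α i + 1) - 2) := by
  classical
  rw [ERexp, Finset.sum_congr rfl fun B hB => by
    rw [beta1_idealOf K (mem_powerset.1 hB), Finset.mul_sum], Finset.sum_comm]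
  refine Finset.sum_congr rfl fun α hα => ?_
  rw [sum_powerset_mem_disjoint _ _ _ _ hα (Finset.filter_subset _ _) (by simp),
    card_filter_lt_monSet hα]

lemma sum_add_one_le_prod (α : Fin n → ℕ) : ∑ i, α i + 1 ≤ ∏ i, (α i + 1) := by
  induction n with
  | zero => simp
  | succ n ih =>
    rw [Fin.sum_univ_succ, Fin.prod_univ_succ]
    nlinarith [ih fun i => α i.succ, Nat.zero_le (∑ i : Fin n, α i.succ), Nat.zero_le (α 0)]

lemma two_le_prod {D : ℕ} {α : Fin n → ℕ} (hα : α ∈ monSet n D) : 2 ≤ ∏ i, (α i + 1) := by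
  have := sum_add_one_le_prod α
  have := (mem_monSet.1 hα).1
  omega

lemma factorizations_subset (n m : ℕ) :
    {a : Fin n → ℕ | (∀ i, 0 < a i) ∧ ∏ i, a i = m + 1} ⊆
      (Fintype.piFinset fun _ : Fin n => Finset.Icc 1 (m + 1) : Finset (Fin n → ℕ)) := by
  rintro a ⟨hpos, hprod⟩
  simp only [Fintype.coe_piFinset, Finset.coe_Icc, Set.mem_pi, Set.mem_Icc]
  refine fun i _ => ⟨hpos i, Nat.le_of_dvd (Nat.succ_pos _) ?_⟩
  rw [← hprod]
  exact Finset.dvd_prod_of_mem a (Finset.mem_univ i)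

lemma finite_factorizations (n m : ℕ) :
    {a : Fin n → ℕ | (∀ i, 0 < a i) ∧ ∏ i, a i = m + 1}.Finite :=
  (Finset.finite_toSet _).subset (factorizations_subset n m)

lemma tauOrd_le (n m : ℕ) : tauOrd n (m + 1) ≤ (m + 1) ^ n := by
  refine (Set.ncard_le_ncard (factorizations_subset n m) (Finset.finite_toSet _)).trans_eq ?_
  rw [Set.ncard_coe_finset, Fintype.card_piFinset]
  simp

lemma card_filter_eq_ncard_image (n D m : ℕ) :
    ((monSet n D).filter fun α => ∏ i, (α i + 1) = m).card =
      ((fun (α : Fin n → ℕ) i => α i + 1) ''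
        {α | α ∈ monSet n D ∧ ∏ i, (α i + 1) = m}).ncard := by
  rw [Set.ncard_image_of_injective, ← Set.ncard_coe_finset, Finset.coe_filter]
  intro α β h
  ext i
  simpa using congrFun h i

lemma card_filter_le_tauOrd (n D m : ℕ) :
    ((monSet n D).filter fun α => ∏ i, (α i + 1) = m + 1).card ≤ tauOrd n (m + 1) := by
  rw [card_filter_eq_ncard_image]
  refine Set.ncard_le_ncard ?_ (finite_factorizations n m)
  rintro _ ⟨α, ⟨-, h⟩, rfl⟩
  exact ⟨fun i => Nat.succ_pos _, h⟩

lemma card_filter_eq_tauOrd {n D m : ℕ} (hm : 2 ≤ m) (hD : m ≤ D) :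
    ((monSet n D).filter fun α => ∏ i, (α i + 1) = m).card = tauOrd n m := by
  rw [card_filter_eq_ncard_image, tauOrd]
  congr 1
  ext a
  constructor
  · rintro ⟨α, ⟨-, h⟩, rfl⟩
    exact ⟨fun i => Nat.succ_pos _, h⟩
  · rintro ⟨hpos, hprod⟩
    have ha : ∀ i, a i - 1 + 1 = a i := fun i => Nat.sub_add_cancel (hpos i)
    have hprod' : ∏ i, (a i - 1 + 1) = m := by simp only [ha, hprod]
    refine ⟨fun i => a i - 1, ⟨mem_monSet.2 ⟨?_, ?_⟩, hprod'⟩, funext ha⟩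
    · rw [Nat.pos_iff_ne_zero]
      intro hs
      have hz : ∀ i, a i - 1 = 0 := fun i => Finset.sum_eq_zero_iff.1 hs i (Finset.mem_univ i)
      simp only [hz, zero_add, Finset.prod_const_one] at hprod'
      omega
    · have := sum_add_one_le_prod fun i => a i - 1
      omega

lemma sum_monSet_eq_tsum (n D : ℕ) (q : ℝ) :
    ∑ α ∈ monSet n D, q ^ (∏ i, (α i + 1) - 2) =
      ∑' j : ℕ, (((monSet n D).filter fun α => ∏ i, (α i + 1) = j + 2).card : ℝ) * q ^ j := by
  have hfiber : ∀ j, (monSet n D).filter (fun α => ∏ i, (α i + 1) - 2 = j) =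
      (monSet n D).filter fun α => ∏ i, (α i + 1) = j + 2 := fun j =>
    Finset.filter_congr fun α hα => by
      have := two_le_prod hα
      omega
  rw [tsum_eq_sum (s := (monSet n D).image fun α => ∏ i, (α i + 1) - 2),
    ← Finset.sum_fiberwise_of_maps_to (g := fun α => ∏ i, (α i + 1) - 2)
      fun α hα => Finset.mem_image_of_mem _ hα]
  · refine Finset.sum_congr rfl fun j _ => ?_
    rw [← hfiber, ← nsmul_eq_mul, ← Finset.sum_const]
    exact Finset.sum_congr rfl fun α hα => by rw [(Finset.mem_filter.1 hα).2]
  · intro j hj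
    rw [← hfiber, Finset.filter_false_of_mem, Finset.card_empty, Nat.cast_zero, zero_mul]
    exact fun α hα h => hj (Finset.mem_image.2 ⟨α, hα, h⟩)

lemma summable_tauOrd_mul_geometric (n : ℕ) {q : ℝ} (hq0 : 0 < q) (hq1 : q < 1) :
    Summable fun j : ℕ => (tauOrd n (j + 2) : ℝ) * q ^ j := by
  have h := (summable_nat_add_iff 2).2 (summable_pow_mul_geometric_of_norm_lt_one n
    (r := q) (by rwa [Real.norm_of_nonneg hq0.le]))
  refine Summable.of_nonneg_of_le (fun j => by positivity) (fun j => ?_) (h.mul_right (q ^ 2)⁻¹)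
  have hle : (tauOrd n (j + 2) : ℝ) ≤ ((j + 2 : ℕ) : ℝ) ^ n := by
    exact_mod_cast tauOrd_le n (j + 1)
  calc (tauOrd n (j + 2) : ℝ) * q ^ j ≤ ((j + 2 : ℕ) : ℝ) ^ n * q ^ j := by gcongr
    _ = ((j + 2 : ℕ) : ℝ) ^ n * q ^ (j + 2) * (q ^ 2)⁻¹ := by
      field_simp
      ring

end RandomMonomialIdeal

/-- Theorem 4.1. For fixed `n` and `p ∈ (0,1)`,
`lim_{D→∞} E[β₁(S/𝔍)] = p Σ_{k=0}^∞ τ_n(k+2) (1-p)^k`. -/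
theorem stmt11 (K : Type*) [Field K] (n : ℕ) (hn : 1 ≤ n)
    (p : ℝ) (hp0 : 0 < p) (hp1 : p < 1) :
    Filter.Tendsto (fun D : ℕ => ERexp n D p fun B => (beta1 K (idealOf K B) : ℝ))
      Filter.atTop (nhds (p * ∑' j : ℕ, (tauOrd n (j + 2) : ℝ) * (1 - p) ^ j)) := by
  have hq0 : 0 < 1 - p := sub_pos.2 hp1
  simp only [ERexp_beta1, ← Finset.mul_sum, sum_monSet_eq_tsum]
  refine Tendsto.const_mul p (tendsto_tsum_of_dominated_convergence
    (summable_tauOrd_mul_geometric n hq0 (by linarith)) (fun j => ?_)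
    (Eventually.of_forall fun D j => ?_))
  · refine tendsto_const_nhds.congr' ?_
    filter_upwards [eventually_ge_atTop (j + 2)] with D hD
    rw [card_filter_eq_tauOrd (by omega) hD]
  · rw [Real.norm_of_nonneg (by positivity)]
    gcongr
    exact card_filter_le_tauOrd n D (j + 1)

end
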